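/- Let C > 0, let γ, η be positive integers and c₁, c₂ > 0. Then there exist a constant C′ > 0 and an integer n₀ ≥ 2, depending only on (C, γ, η, c₁, c₂), such that for every n ≥ n₀ the following holds. Suppose (σ_k)_{k≥1} are nonnegative reals with σ_k ≤ C·k^{−2} for all k, and (Ψ_{kℓ})_{k,ℓ>n} is a symmetric real array such that: (i) Ψ_{k,ℓ+γn} = Ψ_{k,ℓ} for all k, ℓ > n; (ii) for each k > n there is a set S_k ⊆ {1,…,γn} with |S_k| ≤ η such that |Ψ_{k,n+r}| ≤ c₁ for r ∈ S_k and |Ψ_{k,n+r}| ≤ c₂/n for r ∈ {1,…,γn}∖S_k; (iii) the weighted quadratic form q(x) := Σ_{k,ℓ>n} √σ_k·√σ_ℓ·Ψ_{kℓ}·x_k·x_ℓ is nonnegative for every finitely supported real sequence x = (x_k)_{k>n}. Then sup{ q(x) : x finitely supported, Σ_{k>n} x_k² ≤ 1 } ≤ C′·n^{−2}·log n. -/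

import Mathlib

/-- A quadratic form on `F` evaluated at a vector truncated to `U ⊆ F` is the form on `U`. -/
lemma quadForm_truncate {ι : Type*} [DecidableEq ι] {F U : Finset ι} (hU : U ⊆ F)
    (a : ι → ι → ℝ) (x : ι → ℝ) :
    ∑ k ∈ F, ∑ l ∈ F, a k l * (if k ∈ U then x k else 0) * (if l ∈ U then x l else 0)
      = ∑ k ∈ U, ∑ l ∈ U, a k l * x k * x l := by
  have h : F ∩ U = U := Finset.inter_eq_right.mpr hU
  simp only [mul_ite, ite_mul, mul_zero, zero_mul, Finset.sum_ite_mem, h]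
  rw [← h, ← Finset.sum_ite_mem, h]
  refine Finset.sum_congr rfl fun k _ => ?_
  split_ifs <;> simp

/-- Restriction of a positive semidefinite form to a subset of the indices. -/
lemma quadForm_nonneg_subset {ι : Type*} [DecidableEq ι] {F U : Finset ι} (hU : U ⊆ F)
    {a : ι → ι → ℝ} (h : ∀ x : ι → ℝ, 0 ≤ ∑ k ∈ F, ∑ l ∈ F, a k l * x k * x l) (x : ι → ℝ) :
    0 ≤ ∑ k ∈ U, ∑ l ∈ U, a k l * x k * x l := by
  rw [← quadForm_truncate hU]
  exact h _

/-- Schur test for symmetric forms: a bound on absolute row sums bounds the form. -/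
lemma quadForm_le_of_rowSum_le {ι : Type*} {U : Finset ι} {a : ι → ι → ℝ} {B : ℝ}
    (hsymm : ∀ k ∈ U, ∀ l ∈ U, a k l = a l k)
    (hrow : ∀ k ∈ U, ∑ l ∈ U, |a k l| ≤ B) (x : ι → ℝ) :
    ∑ k ∈ U, ∑ l ∈ U, a k l * x k * x l ≤ B * ∑ k ∈ U, x k ^ 2 := by
  have hpt : ∀ k ∈ U, ∀ l ∈ U,
      a k l * x k * x l ≤ |a k l| * x k ^ 2 / 2 + |a l k| * x l ^ 2 / 2 := by
    intro k hk l hl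
    rw [← hsymm k hk l hl]
    have h1 : a k l * x k * x l ≤ |a k l| * |x k * x l| := by
      rw [← abs_mul, ← mul_assoc]
      exact le_abs_self _
    have h2 : |x k * x l| ≤ (x k ^ 2 + x l ^ 2) / 2 := by
      rw [abs_le]
      constructor <;> nlinarith [sq_nonneg (x k + x l), sq_nonneg (x k - x l)]
    nlinarith [mul_le_mul_of_nonneg_left h2 (abs_nonneg (a k l))]
  calc ∑ k ∈ U, ∑ l ∈ U, a k l * x k * x l
      ≤ ∑ k ∈ U, ∑ l ∈ U, (|a k l| * x k ^ 2 / 2 + |a l k| * x l ^ 2 / 2) :=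
        Finset.sum_le_sum fun k hk => Finset.sum_le_sum fun l hl => hpt k hk l hl
    _ = ∑ k ∈ U, (∑ l ∈ U, |a k l|) * x k ^ 2 := by
        simp only [Finset.sum_add_distrib]
        rw [Finset.sum_comm (f := fun k l => |a l k| * x l ^ 2 / 2), ← Finset.sum_add_distrib]
        refine Finset.sum_congr rfl fun k _ => ?_
        rw [← Finset.sum_add_distrib, Finset.sum_mul]
        exact Finset.sum_congr rfl fun l _ => by ring
    _ ≤ ∑ k ∈ U, B * x k ^ 2 :=
        Finset.sum_le_sum fun k hk => mul_le_mul_of_nonneg_right (hrow k hk) (sq_nonneg _)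
    _ = B * ∑ k ∈ U, x k ^ 2 := by rw [Finset.mul_sum]

/-- Diagonal entries of a positive semidefinite form are nonnegative. -/
lemma diag_nonneg_of_quadForm_nonneg {ι : Type*} [DecidableEq ι] {V : Finset ι} {a : ι → ι → ℝ}
    (h : ∀ x : ι → ℝ, 0 ≤ ∑ k ∈ V, ∑ l ∈ V, a k l * x k * x l) {k : ι} (hk : k ∈ V) :
    0 ≤ a k k := by
  simpa using quadForm_nonneg_subset (Finset.singleton_subset_iff.mpr hk) h fun _ => 1

/-- Nonnegativity of the `2 × 2` principal minors of a positive semidefinite form. -/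
lemma sq_entry_le_of_quadForm_nonneg {ι : Type*} [DecidableEq ι] {V : Finset ι} {a : ι → ι → ℝ}
    (hsymm : ∀ k ∈ V, ∀ l ∈ V, a k l = a l k)
    (h : ∀ x : ι → ℝ, 0 ≤ ∑ k ∈ V, ∑ l ∈ V, a k l * x k * x l)
    {k l : ι} (hk : k ∈ V) (hl : l ∈ V) : a k l ^ 2 ≤ a k k * a l l := by
  rcases eq_or_ne k l with rfl | hkl
  · exact (sq _).le
  have hpair : ({k, l} : Finset ι) ⊆ V := by
    intro i hi
    rcases Finset.mem_insert.mp hi with rfl | hi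
    · exact hk
    · rwa [Finset.mem_singleton.mp hi]
  have hquad : ∀ t : ℝ, 0 ≤ a k k * (t * t) + 2 * a k l * t + a l l := by
    intro t
    have := quadForm_nonneg_subset hpair h fun i => if i = k then t else 1
    simp only [Finset.sum_pair hkl, if_true, if_neg hkl.symm, ← hsymm k hk l hl] at this
    linarith
  have := discrim_le_zero hquad
  unfold discrim at this
  linarith

/-- A positive semidefinite form is bounded by its trace. -/
lemma quadForm_le_trace {ι : Type*} [DecidableEq ι] {V : Finset ι} {a : ι → ι → ℝ}
    (hsymm : ∀ k ∈ V, ∀ l ∈ V, a k l = a l k)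
    (h : ∀ x : ι → ℝ, 0 ≤ ∑ k ∈ V, ∑ l ∈ V, a k l * x k * x l) (x : ι → ℝ) :
    ∑ k ∈ V, ∑ l ∈ V, a k l * x k * x l ≤ (∑ k ∈ V, a k k) * ∑ k ∈ V, x k ^ 2 := by
  have hdiag : ∀ k ∈ V, 0 ≤ a k k := fun k hk => diag_nonneg_of_quadForm_nonneg h hk
  calc ∑ k ∈ V, ∑ l ∈ V, a k l * x k * x l
      ≤ ∑ k ∈ V, ∑ l ∈ V, (√(a k k) * |x k|) * (√(a l l) * |x l|) := by
        refine Finset.sum_le_sum fun k hk => Finset.sum_le_sum fun l hl => ?_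
        have h1 : |a k l| ≤ √(a k k) * √(a l l) := by
          rw [← Real.sqrt_mul (hdiag k hk)]
          exact Real.abs_le_sqrt (sq_entry_le_of_quadForm_nonneg hsymm h hk hl)
        calc a k l * x k * x l ≤ |a k l * x k * x l| := le_abs_self _
          _ = |a k l| * (|x k| * |x l|) := by rw [abs_mul, abs_mul, mul_assoc]
          _ ≤ √(a k k) * √(a l l) * (|x k| * |x l|) := by gcongr
          _ = _ := by ring
    _ = (∑ k ∈ V, √(a k k) * |x k|) ^ 2 := by rw [sq, Finset.sum_mul_sum]
    _ ≤ (∑ k ∈ V, √(a k k) ^ 2) * ∑ k ∈ V, |x k| ^ 2 := Finset.sum_mul_sq_le_sq_mul_sq _ _ _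
    _ = (∑ k ∈ V, a k k) * ∑ k ∈ V, x k ^ 2 := by
        simp only [sq_abs]
        rw [Finset.sum_congr rfl fun k hk => Real.sq_sqrt (hdiag k hk)]

/-- A positive semidefinite form is at most twice the sum of its restrictions to two
complementary blocks of coordinates. -/
lemma quadForm_le_two_mul_blocks {ι : Type*} [DecidableEq ι] {U V : Finset ι}
    (hUV : Disjoint U V) {a : ι → ι → ℝ}
    (h : ∀ x : ι → ℝ, 0 ≤ ∑ k ∈ U ∪ V, ∑ l ∈ U ∪ V, a k l * x k * x l) (x : ι → ℝ) :
    ∑ k ∈ U ∪ V, ∑ l ∈ U ∪ V, a k l * x k * x l ≤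
      2 * (∑ k ∈ U, ∑ l ∈ U, a k l * x k * x l) + 2 * ∑ k ∈ V, ∑ l ∈ V, a k l * x k * x l := by
  set u : ι → ℝ := fun k => if k ∈ U then x k else 0 with hu
  set v : ι → ℝ := fun k => if k ∈ V then x k else 0 with hv
  have hx : ∀ k ∈ U ∪ V, x k = u k + v k := by
    intro k hk
    rcases Finset.mem_union.mp hk with hk | hk
    · simp [hu, hv, hk, Finset.disjoint_left.mp hUV hk]
    · simp [hu, hv, hk, Finset.disjoint_right.mp hUV hk]
  rw [← quadForm_truncate (Finset.subset_union_left : U ⊆ U ∪ V) a x,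
    ← quadForm_truncate (Finset.subset_union_right : V ⊆ U ∪ V) a x]
  have hpar : ∑ k ∈ U ∪ V, ∑ l ∈ U ∪ V, a k l * x k * x l
      + ∑ k ∈ U ∪ V, ∑ l ∈ U ∪ V, a k l * (u k - v k) * (u l - v l)
      = 2 * (∑ k ∈ U ∪ V, ∑ l ∈ U ∪ V, a k l * u k * u l)
        + 2 * ∑ k ∈ U ∪ V, ∑ l ∈ U ∪ V, a k l * v k * v l := by
    simp only [Finset.mul_sum, ← Finset.sum_add_distrib]
    refine Finset.sum_congr rfl fun k hk => Finset.sum_congr rfl fun l hl => ?_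
    rw [hx k hk, hx l hl]
    ring
  linarith [h fun k => u k - v k]

/-- Splitting an interval of length `J * P` into `J` periods. -/
lemma sum_Ioc_add_mul_eq_sum_periods (f : ℕ → ℝ) (n P J : ℕ) :
    ∑ l ∈ Finset.Ioc n (n + J * P), f l
      = ∑ j ∈ Finset.range J, ∑ r ∈ Finset.Icc 1 P, f (n + r + j * P) := by
  induction J with
  | zero => simp
  | succ J ih =>
    rw [Finset.sum_range_succ, ← ih,
      ← Finset.sum_Ioc_consecutive f (Nat.le_add_right n (J * P))
        (Nat.add_le_add_left (Nat.mul_le_mul_right P J.le_succ) n)]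
    congr 1
    symm
    refine Finset.sum_nbij (fun r => n + r + J * P) ?_ ?_ ?_ fun _ _ => rfl
    · intro r hr
      simp only [Finset.mem_Icc, Finset.mem_Ioc, Nat.succ_mul] at hr ⊢
      omega
    · intro r _ s _ hrs
      simp only at hrs
      omega
    · intro l hl
      simp only [Finset.coe_Ioc, Set.mem_Ioc, Nat.succ_mul] at hl
      refine ⟨l - n - J * P, ?_, ?_⟩
      · simp only [Finset.coe_Icc, Set.mem_Icc]
        omega
      · simp only
        omega

/-- A function with period `P` beyond `n`, evaluated some periods later. -/
lemma eq_of_periodic_tail {f : ℕ → ℝ} {n P : ℕ} (hf : ∀ l, n < l → f (l + P) = f l)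
    {l : ℕ} (hl : n < l) (j : ℕ) : f (l + j * P) = f l := by
  induction j with
  | zero => simp
  | succ j ih => rw [Nat.succ_mul, ← add_assoc, hf _ (by omega), ih]

/-- A tail-periodic function is bounded by any bound on its first period. -/
lemma abs_le_of_periodic_tail {f : ℕ → ℝ} {n P : ℕ} {c : ℝ} (hP : 0 < P)
    (hf : ∀ l, n < l → f (l + P) = f l) (hc : ∀ r ∈ Finset.Icc 1 P, |f (n + r)| ≤ c)
    {l : ℕ} (hl : n < l) : |f l| ≤ c := by
  have hdiv := Nat.div_add_mod' (l - n - 1) P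
  have hmod := Nat.mod_lt (l - n - 1) hP
  have heq : l = n + ((l - n - 1) % P + 1) + (l - n - 1) / P * P := by omega
  rw [heq, eq_of_periodic_tail hf (by omega)]
  exact hc _ (Finset.mem_Icc.mpr (by omega))

/-- The sum of a tail-periodic nonnegative function against `1 / l` over `J` periods. -/
lemma sum_abs_div_le_of_periodic_tail {f : ℕ → ℝ} {n P J : ℕ} {A : ℝ} (hn : 0 < n) (hnP : n ≤ P)
    (hf : ∀ l, n < l → f (l + P) = f l) (hA : ∑ r ∈ Finset.Icc 1 P, |f (n + r)| ≤ A) :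
    ∑ l ∈ Finset.Ioc n (n + J * P), |f l| / l ≤ A / n * (1 + Real.log J) := by
  have hA0 : 0 ≤ A := (Finset.sum_nonneg fun _ _ => abs_nonneg _).trans hA
  have hharm : ∑ j ∈ Finset.range J, ((j : ℝ) + 1)⁻¹ ≤ 1 + Real.log J := by
    simpa [harmonic] using harmonic_le_one_add_log J
  rw [sum_Ioc_add_mul_eq_sum_periods]
  calc ∑ j ∈ Finset.range J, ∑ r ∈ Finset.Icc 1 P,
        |f (n + r + j * P)| / ((n + r + j * P : ℕ) : ℝ)
      ≤ ∑ j ∈ Finset.range J, ∑ r ∈ Finset.Icc 1 P, |f (n + r)| * (((j : ℝ) + 1)⁻¹ / n) := by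
        refine Finset.sum_le_sum fun j _ => Finset.sum_le_sum fun r hr => ?_
        have hr1 := (Finset.mem_Icc.mp hr).1
        rw [eq_of_periodic_tail hf (by omega), div_eq_mul_inv]
        refine mul_le_mul_of_nonneg_left ?_ (abs_nonneg _)
        rw [inv_eq_one_div, inv_eq_one_div, div_div]
        refine one_div_le_one_div_of_le (by positivity) ?_
        have : (j + 1) * n ≤ n + r + j * P := by nlinarith [Nat.mul_le_mul_left j hnP]
        exact_mod_cast this
    _ = (∑ r ∈ Finset.Icc 1 P, |f (n + r)|) * ((∑ j ∈ Finset.range J, ((j : ℝ) + 1)⁻¹) / n) := by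
        simp only [← Finset.sum_mul, ← Finset.mul_sum, ← Finset.sum_div]
    _ ≤ A * ((1 + Real.log J) / n) := by gcongr
    _ = A / n * (1 + Real.log J) := by ring

/-- The sum over a period of a function with few large values. -/
lemma sum_le_of_sparse {ι : Type*} [DecidableEq ι] {I S : Finset ι} {g : ι → ℝ} {c d : ℝ} {η : ℕ}
    (hS : S ⊆ I) (hη : S.card ≤ η) (hc : 0 ≤ c) (hd : 0 ≤ d) (hlarge : ∀ r ∈ S, g r ≤ c)
    (hsmall : ∀ r ∈ I, r ∉ S → g r ≤ d) :
    ∑ r ∈ I, g r ≤ η * c + I.card * d := by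
  rw [← Finset.sum_sdiff hS, add_comm]
  have h1 : ∑ r ∈ S, g r ≤ S.card * c := by
    simpa using Finset.sum_le_card_nsmul S g c hlarge
  have h2 : ∑ r ∈ I \ S, g r ≤ (I \ S).card * d := by
    simpa using Finset.sum_le_card_nsmul (I \ S) g d fun r hr =>
      hsmall r (Finset.mem_sdiff.mp hr).1 (Finset.mem_sdiff.mp hr).2
  have h3 : (S.card : ℝ) * c ≤ η * c := by gcongr
  have h4 : ((I \ S).card : ℝ) * d ≤ I.card * d := by
    gcongr
    exact Finset.sdiff_subset
  linarith

/-- Double series of a quadratic form at a vector supported in a finite set. -/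
lemma tsum_quadForm_eq_sum {ι : Type*} {F : Finset ι} (a : ι → ι → ℝ) {x : ι → ℝ}
    (hx : ∀ k ∉ F, x k = 0) :
    ∑' k, ∑' l, a k l * x k * x l = ∑ k ∈ F, ∑ l ∈ F, a k l * x k * x l := by
  rw [tsum_eq_sum (s := F) fun k hk => by simp [hx k hk]]
  exact Finset.sum_congr rfl fun k _ => tsum_eq_sum fun l hl => by simp [hx l hl]


/-- sparse periodic lemma, part (b), boundary case `α = 2`.
`Ψ` is the tail block (indices `> n`) of a Gram-type matrix: symmetric, with rows periodic
of period `γ n`, having in each period at most `η` entries of size `≤ c₁` and all the others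
of size `≤ c₂ / n`; the weights satisfy `σ_k ≤ C k^{-2}`, and the weighted quadratic form
`q(x) = ∑_{k,ℓ>n} √σ_k √σ_ℓ Ψ_{kℓ} x_k x_ℓ` is positive semidefinite on finitely supported
sequences.  Then `λ_max`, i.e. the supremum of `q` over the unit ball of finitely supported
sequences vanishing on indices `≤ n`, is at most `C' n^{-2} log n` for all `n ≥ n₀`, where
`C' > 0` and `n₀ ≥ 2` depend only on `(C, γ, η, c₁, c₂)`. -/
theorem stmt8
    (C : ℝ) (hC : 0 < C)
    (γ η : ℕ) (hγ : 1 ≤ γ) (hη : 1 ≤ η)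
    (c₁ c₂ : ℝ) (hc₁ : 0 < c₁) (hc₂ : 0 < c₂) :
    ∃ (C' : ℝ) (n₀ : ℕ), 0 < C' ∧ 2 ≤ n₀ ∧
      ∀ n : ℕ, n₀ ≤ n →
      ∀ (σ : ℕ → ℝ) (Ψ : ℕ → ℕ → ℝ),
        (∀ k : ℕ, 1 ≤ k → 0 ≤ σ k ∧ σ k ≤ C / (k : ℝ) ^ 2) →
        (∀ k ℓ : ℕ, n < k → n < ℓ → Ψ k ℓ = Ψ ℓ k) →
        (∀ k ℓ : ℕ, n < k → n < ℓ → Ψ k (ℓ + γ * n) = Ψ k ℓ) →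
        (∀ k : ℕ, n < k → ∃ S : Finset ℕ, S ⊆ Finset.Icc 1 (γ * n) ∧ S.card ≤ η ∧
          (∀ r ∈ S, |Ψ k (n + r)| ≤ c₁) ∧
          (∀ r ∈ Finset.Icc 1 (γ * n), r ∉ S → |Ψ k (n + r)| ≤ c₂ / n)) →
        (∀ x : ℕ → ℝ, (Function.support x).Finite → (∀ k ≤ n, x k = 0) →
          0 ≤ ∑' k : ℕ, ∑' ℓ : ℕ,
            Real.sqrt (σ k) * Real.sqrt (σ ℓ) * Ψ k ℓ * x k * x ℓ) →
        ∀ x : ℕ → ℝ, (Function.support x).Finite → (∀ k ≤ n, x k = 0) →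
          (∑' k : ℕ, x k ^ 2) ≤ 1 →
          (∑' k : ℕ, ∑' ℓ : ℕ,
              Real.sqrt (σ k) * Real.sqrt (σ ℓ) * Ψ k ℓ * x k * x ℓ)
            ≤ C' * Real.log n / (n : ℝ) ^ 2 := by
  set A : ℝ := η * c₁ + γ * c₂ with hA_def
  have hη0 : (0 : ℝ) < η := by exact_mod_cast hη
  have hA : 0 < A := by positivity
  refine ⟨2 * (C * A * 2 + C * (c₁ + c₂)), 3, by positivity, by norm_num, ?_⟩
  intro n hn σ Ψ hσ hsymm hper hsparse hpsd x hxfin hx0 hx1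
  have hn0 : 0 < n := by omega
  have hnR : (0 : ℝ) < n := by exact_mod_cast hn0
  have hn1 : (1 : ℝ) ≤ n := by exact_mod_cast hn0
  have hlog : 1 ≤ Real.log n := by
    rw [Real.le_log_iff_exp_le hnR]
    have h3 : (3 : ℝ) ≤ n := by exact_mod_cast hn
    linarith [Real.exp_one_lt_d9]
  have hnP : n ≤ γ * n := Nat.le_mul_of_pos_left n hγ
  have hperiod : ∀ k, n < k → ∑ r ∈ Finset.Icc 1 (γ * n), |Ψ k (n + r)| ≤ A := by
    intro k hk
    obtain ⟨S, hS, hcard, hlarge, hsmall⟩ := hsparse k hk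
    refine (sum_le_of_sparse hS hcard hc₁.le (by positivity) hlarge hsmall).trans_eq ?_
    rw [hA_def, Nat.card_Icc, Nat.add_sub_cancel]
    push_cast
    field_simp
  have hentry : ∀ k, n < k → Ψ k k ≤ c₁ + c₂ := by
    intro k hk
    obtain ⟨S, -, -, hlarge, hsmall⟩ := hsparse k hk
    refine (le_abs_self _).trans (abs_le_of_periodic_tail (hn0.trans_le hnP)
      (fun l hl => hper k l hk hl) (fun r hr => ?_) hk)
    by_cases hrS : r ∈ S
    · linarith [hlarge r hrS]
    · linarith [hsmall r hr hrS, div_le_self hc₂.le hn1]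
  have hsqrt : ∀ k, n < k → √(σ k) ≤ √C / k := by
    intro k hk
    rw [← Real.sqrt_sq (Nat.cast_nonneg k : (0 : ℝ) ≤ k), ← Real.sqrt_div hC.le]
    exact Real.sqrt_le_sqrt (hσ k (by omega)).2
  set a : ℕ → ℕ → ℝ := fun k l => √(σ k) * √(σ l) * Ψ k l with ha
  obtain ⟨M, hM⟩ := hxfin.bddAbove
  set U := Finset.Ioc n (n ^ 2) with hU
  set V := Finset.Ioc (n ^ 2) (max M (n ^ 2)) with hV
  have hnn : n ≤ n ^ 2 := Nat.le_self_pow two_ne_zero n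
  have hUV : Disjoint U V := Finset.Ioc_disjoint_Ioc_of_le le_rfl
  have hF : ∀ k ∈ U ∪ V, n < k := by
    intro k hk
    simp only [hU, hV, Finset.mem_union, Finset.mem_Ioc] at hk
    omega
  have hxF : ∀ k ∉ U ∪ V, x k = 0 := by
    intro k hk
    by_contra hxk
    have h1 : k ≤ M := hM hxk
    have h2 : n < k := by
      by_contra h
      exact hxk (hx0 k (by omega))
    refine hk ?_
    simp only [hU, hV, Finset.mem_union, Finset.mem_Ioc, le_max_iff]
    omega
  have hpsdF : ∀ y : ℕ → ℝ, 0 ≤ ∑ k ∈ U ∪ V, ∑ l ∈ U ∪ V, a k l * y k * y l := by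
    intro y
    set z : ℕ → ℝ := fun k => if k ∈ U ∪ V then y k else 0 with hz
    have hz0 : ∀ k ∉ U ∪ V, z k = 0 := fun k hk => if_neg hk
    have hfin : (Function.support z).Finite :=
      (U ∪ V).finite_toSet.subset fun k hk => by
        by_contra h
        exact hk (hz0 k h)
    have := hpsd z hfin fun k hk => hz0 k fun h => absurd (hF k h) (by omega)
    rwa [tsum_quadForm_eq_sum a hz0, quadForm_truncate subset_rfl] at this
  have hsymmF : ∀ k ∈ U ∪ V, ∀ l ∈ U ∪ V, a k l = a l k := by
    intro k hk l hl
    simp only [ha, hsymm k l (hF k hk) (hF l hl)]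
    ring
  have hUF : U ⊆ U ∪ V := Finset.subset_union_left
  have hVF : V ⊆ U ∪ V := Finset.subset_union_right
  have hrow : ∀ k ∈ U, ∑ l ∈ U, |a k l| ≤ C * A * 2 * (Real.log n / n ^ 2) := by
    intro k hk
    have hnk : n < k := hF k (hUF hk)
    have hkR : (n : ℝ) ≤ k := by exact_mod_cast hnk.le
    have hle : ∀ l ∈ U, |a k l| ≤ C / n * (|Ψ k l| / l) := by
      intro l hl
      have h2 : √(σ k) ≤ √C / n := (hsqrt k hnk).trans (by gcongr)
      have h3 := hsqrt l (hF l (hUF hl))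
      calc |a k l| = √(σ k) * √(σ l) * |Ψ k l| := by
            simp only [ha, abs_mul, abs_of_nonneg (Real.sqrt_nonneg _)]
        _ ≤ (√C / n) * (√C / l) * |Ψ k l| := by gcongr
        _ = (√C * √C) / n * (|Ψ k l| / l) := by ring
        _ = C / n * (|Ψ k l| / l) := by rw [Real.mul_self_sqrt hC.le]
    have hsub : U ⊆ Finset.Ioc n (n + n * (γ * n)) :=
      Finset.Ioc_subset_Ioc_right (by nlinarith [Nat.mul_le_mul_left n hnP])
    calc ∑ l ∈ U, |a k l| ≤ ∑ l ∈ U, C / n * (|Ψ k l| / l) := Finset.sum_le_sum hle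
      _ = C / n * ∑ l ∈ U, |Ψ k l| / l := by rw [Finset.mul_sum]
      _ ≤ C / n * ∑ l ∈ Finset.Ioc n (n + n * (γ * n)), |Ψ k l| / l := by
          gcongr
      _ ≤ C / n * (A / n * (1 + Real.log n)) := by
          gcongr
          exact sum_abs_div_le_of_periodic_tail hn0 hnP (fun l hl => hper k l hnk hl)
            (hperiod k hnk)
      _ ≤ C / n * (A / n * (2 * Real.log n)) := by
          gcongr
          linarith
      _ = C * A * 2 * (Real.log n / n ^ 2) := by ring
  have htrace : ∑ k ∈ V, a k k ≤ C * (c₁ + c₂) * (Real.log n / n ^ 2) := by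
    have hle : ∀ k ∈ V, a k k ≤ C * (c₁ + c₂) * ((k : ℝ) ^ 2)⁻¹ := by
      intro k hk
      have hnk := hF k (hVF hk)
      obtain ⟨h0, h1⟩ := hσ k (by omega)
      calc a k k = σ k * Ψ k k := by simp only [ha, Real.mul_self_sqrt h0]
        _ ≤ σ k * (c₁ + c₂) := by
            gcongr
            exact hentry k hnk
        _ ≤ C / k ^ 2 * (c₁ + c₂) := by gcongr
        _ = C * (c₁ + c₂) * ((k : ℝ) ^ 2)⁻¹ := by ring
    have hsum : ∑ k ∈ V, ((k : ℝ) ^ 2)⁻¹ ≤ Real.log n / n ^ 2 := by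
      have h1 := sum_Ioc_inv_sq_le_sub (α := ℝ) (pow_pos hn0 2).ne' (le_max_right M (n ^ 2))
      have h2 : (0 : ℝ) ≤ ((max M (n ^ 2) : ℕ) : ℝ)⁻¹ := by positivity
      have h3 : (((n ^ 2 : ℕ) : ℝ))⁻¹ ≤ Real.log n / n ^ 2 := by
        rw [inv_eq_one_div]
        push_cast
        gcongr
      linarith
    calc ∑ k ∈ V, a k k ≤ ∑ k ∈ V, C * (c₁ + c₂) * ((k : ℝ) ^ 2)⁻¹ := Finset.sum_le_sum hle
      _ = C * (c₁ + c₂) * ∑ k ∈ V, ((k : ℝ) ^ 2)⁻¹ := by rw [Finset.mul_sum]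
      _ ≤ _ := by gcongr
  have hnorm : ∀ W ⊆ U ∪ V, ∑ k ∈ W, x k ^ 2 ≤ 1 := by
    intro W hW
    rw [tsum_eq_sum (s := U ∪ V) fun k hk => by simp [hxF k hk]] at hx1
    exact (Finset.sum_le_sum_of_subset_of_nonneg hW fun _ _ _ => sq_nonneg _).trans hx1
  have hbound : (0 : ℝ) ≤ Real.log n / n ^ 2 := by positivity
  have hQU : ∑ k ∈ U, ∑ l ∈ U, a k l * x k * x l ≤ C * A * 2 * (Real.log n / n ^ 2) :=
    (quadForm_le_of_rowSum_le (fun k hk l hl => hsymmF k (hUF hk) l (hUF hl)) hrow x).trans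
      (mul_le_of_le_one_right (by positivity) (hnorm U hUF))
  have hQV : ∑ k ∈ V, ∑ l ∈ V, a k l * x k * x l ≤ C * (c₁ + c₂) * (Real.log n / n ^ 2) :=
    (quadForm_le_trace (fun k hk l hl => hsymmF k (hVF hk) l (hVF hl))
      (quadForm_nonneg_subset hVF hpsdF) x).trans <|
      (mul_le_mul_of_nonneg_right htrace (Finset.sum_nonneg fun _ _ => sq_nonneg _)).trans
      (mul_le_of_le_one_right (by positivity) (hnorm V hVF))
  calc ∑' k, ∑' l, a k l * x k * x l
      = ∑ k ∈ U ∪ V, ∑ l ∈ U ∪ V, a k l * x k * x l := tsum_quadForm_eq_sum a hxF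
    _ ≤ _ := quadForm_le_two_mul_blocks hUV hpsdF x
    _ ≤ 2 * (C * A * 2 * (Real.log n / n ^ 2)) + 2 * (C * (c₁ + c₂) * (Real.log n / n ^ 2)) := by
        gcongr
    _ = 2 * (C * A * 2 + C * (c₁ + c₂)) * Real.log n / n ^ 2 := by ring
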